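/- For every integer n ≥ 0, F_{n+1}(q) = Σ_{j : 0 ≤ 2j ≤ n} q^{j²} · [n−j choose j]_q in ℤ[q]. -/

import Mathlib

open Polynomial

/-- The Schur q-Fibonacci polynomials: F₀ = 0, F₁ = 1, Fₙ = Fₙ₋₁ + q^(n-2) Fₙ₋₂. -/
noncomputable def qF : ℕ → Polynomial ℤ
  | 0 => 0
  | 1 => 1
  | n + 2 => qF (n + 1) + X ^ n * qF n
/-- The Gaussian (q-)binomial coefficient [n choose m]_q ∈ ℤ[q], defined via the
Pascal-type recurrence [n+1 choose m]_q = q^m [n choose m]_q + [n choose m-1]_q;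
it equals ((1-q^n)⋯(1-q^(n-m+1)))/((1-q^m)⋯(1-q)) for 0 ≤ m ≤ n and is 0 for m > n. -/
noncomputable def qbinom : ℕ → ℕ → Polynomial ℤ
  | _, 0 => 1
  | 0, _ + 1 => 0
  | n + 1, m + 1 => X ^ (m + 1) * qbinom n (m + 1) + qbinom n m

theorem qbinom_zero_right' (n : ℕ) : qbinom n 0 = 1 := by
  cases n <;> simp [qbinom]

theorem qbinom_succ' (n m : ℕ) :
    qbinom (n + 1) (m + 1) = X ^ (m + 1) * qbinom n (m + 1) + qbinom n m := by
  simp [qbinom]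

theorem qbinom_eq_zero' (n : ℕ) : ∀ m, n < m → qbinom n m = 0 := by
  induction n with
  | zero =>
    intro m h
    obtain ⟨m, rfl⟩ := Nat.exists_eq_succ_of_ne_zero (by omega : m ≠ 0)
    simp [qbinom]
  | succ n ih =>
    intro m h
    obtain ⟨m, rfl⟩ := Nat.exists_eq_succ_of_ne_zero (by omega : m ≠ 0)
    rw [Nat.succ_eq_add_one, qbinom_succ', ih _ (by omega), ih _ (by omega)]
    simp

theorem qbinom_pascal' (n : ℕ) : ∀ m k, n = m + k →
    qbinom (n + 1) (m + 1) = qbinom n (m + 1) + X ^ k * qbinom n m := by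
  induction n with
  | zero =>
    intro m k h
    obtain rfl : m = 0 := by omega
    obtain rfl : k = 0 := by omega
    simp [qbinom]
  | succ n ih =>
    intro m k h
    rcases k with _ | k
    · rw [qbinom_succ', qbinom_eq_zero' (n + 1) (m + 1) (by omega)]
      simp
    · rw [qbinom_succ' (n + 1) m]
      have h1 := ih m k (by omega)
      have h2 := qbinom_succ' n m
      rcases m with _ | m
      · simp only [qbinom_zero_right'] at *
        linear_combination X * h1 - h2
      · have h3 := ih m (k + 1) (by omega)
        have h4 := qbinom_succ' n m
        linear_combination X ^ (m + 2) * h1 + h3 - h2 - X ^ (k + 1) * h4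

/-- For n ≥ 0, F_{n+1}(q) = Σ_{0 ≤ 2j ≤ n} q^(j²) [n−j choose j]_q. -/
theorem qFib_sum_formula (n : ℕ) :
    qF (n + 1) = ∑ j ∈ Finset.range (n / 2 + 1), X ^ (j ^ 2) * qbinom (n - j) j := by
  induction n using Nat.twoStepInduction with
  | zero => simp [qF, qbinom]
  | one => simp [qF, qbinom]
  | more n ih0 ih1 =>
    have hsub : ∑ j ∈ Finset.range ((n + 1) / 2 + 1), X ^ (j ^ 2) * qbinom (n + 1 - j) j
        = ∑ j ∈ Finset.range (n / 2 + 1 + 1), X ^ (j ^ 2) * qbinom (n + 1 - j) j := by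
      apply Finset.sum_subset
      · intro j
        simp only [Finset.mem_range]
        omega
      · intro j _ h2
        simp only [Finset.mem_range] at h2
        rw [qbinom_eq_zero' _ _ (by omega), mul_zero]
    have hq : qF (n + 2 + 1) = qF (n + 1 + 1) + X ^ (n + 1) * qF (n + 1) := by
      rw [qF]
    rw [hq, ih1, ih0, hsub, show (n + 2) / 2 + 1 = n / 2 + 1 + 1 by omega,
      Finset.sum_range_succ' _ (n / 2 + 1), Finset.sum_range_succ' _ (n / 2 + 1),
      Finset.mul_sum, add_right_comm, ← Finset.sum_add_distrib]
    simp only [qbinom_zero_right']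
    congr 1
    apply Finset.sum_congr rfl
    intro j hj
    rw [Finset.mem_range] at hj
    obtain ⟨k, rfl⟩ : ∃ k, n = j + j + k := ⟨n - (j + j), by omega⟩
    rw [show j + j + k + 1 - (j + 1) = j + k by omega,
      show j + j + k + 2 - (j + 1) = j + k + 1 by omega,
      show j + j + k - j = j + k by omega, qbinom_pascal' (j + k) j k rfl]
    ring
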